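/- arXiv:math/0410078 — 2 statements merged into one kernel-verified Lean document; each statement's English description precedes it below -/
import Mathlib

section
/- Let N ≥ 3, let Ω and B be open subsets of ℝ^N with B bounded, and let χ : ℝ^N → [0,1] be a smooth function with compact support that equals 1 on the closure of B. If (v_k) is a sequence of smooth functions with compact support contained in Ω ∪ B such that sup_k ∫ |∇v_k|² < ∞ and ∫_{supp χ} v_k² → 0, then liminf_{k→∞} ( ∫ |∇v_k|² − ∫ |∇((1−χ) v_k)|² ) ≥ 0. -/
open MeasureTheory Filter Topology

/-- The Dirichlet energy `∫ |∇u|²` of a function on `ℝᴺ`. -/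
noncomputable def grad2 (N : ℕ) (u : EuclideanSpace ℝ (Fin N) → ℝ) : ℝ :=
  ∫ x, ‖fderiv ℝ u x‖ ^ 2

/-- The weighted mass `∫ V u²`. -/
noncomputable def ven (N : ℕ) (V u : EuclideanSpace ℝ (Fin N) → ℝ) : ℝ :=
  ∫ x, V x * u x ^ 2

/-- A smooth test function with compact support contained in `Ω`. -/
def IsTest (N : ℕ) (Ω : Set (EuclideanSpace ℝ (Fin N)))
    (u : EuclideanSpace ℝ (Fin N) → ℝ) : Prop :=
  ContDiff ℝ (⊤ : ℕ∞) u ∧ HasCompactSupport u ∧ tsupport u ⊆ Ω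

/-- The Rayleigh quotient infimum `μ_Ω`. -/
noncomputable def mu (N : ℕ) (V : EuclideanSpace ℝ (Fin N) → ℝ)
    (Ω : Set (EuclideanSpace ℝ (Fin N))) : ℝ :=
  sInf {q : ℝ | ∃ u, IsTest N Ω u ∧ 0 < ven N V u ∧ q = grad2 N u / ven N V u}

/-- A normalized minimizing sequence for `μ_Ω`. -/
def MinimizingSeq (N : ℕ) (V : EuclideanSpace ℝ (Fin N) → ℝ)
    (Ω : Set (EuclideanSpace ℝ (Fin N)))
    (u : ℕ → EuclideanSpace ℝ (Fin N) → ℝ) : Prop :=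
  (∀ k, IsTest N Ω (u k)) ∧ (∀ k, ven N V (u k) = 1) ∧
    Tendsto (fun k => grad2 N (u k)) atTop (𝓝 (mu N V Ω))

/-- The gradients `∇u_k` form a Cauchy sequence in `L²(ℝᴺ; ℝᴺ)`. -/
def GradCauchy (N : ℕ) (u : ℕ → EuclideanSpace ℝ (Fin N) → ℝ) : Prop :=
  ∀ ε : ℝ, 0 < ε → ∃ M : ℕ, ∀ j ≥ M, ∀ l ≥ M,
    (∫ x, ‖fderiv ℝ (u j) x - fderiv ℝ (u l) x‖ ^ 2) < ε

/-- `V` is locally `L^p` on `X`. -/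
def LocLp (N : ℕ) (p : ℝ) (V : EuclideanSpace ℝ (Fin N) → ℝ)
    (X : Set (EuclideanSpace ℝ (Fin N))) : Prop :=
  ∀ K : Set (EuclideanSpace ℝ (Fin N)), IsCompact K → K ⊆ X →
    IntegrableOn (fun x => V x ^ p) K

/-- A smooth test function has integrable squared gradient. -/
theorem IsTest.integrable_sq_norm_fderiv {N : ℕ} {Ω : Set (EuclideanSpace ℝ (Fin N))}
    {u : EuclideanSpace ℝ (Fin N) → ℝ} (hu : IsTest N Ω u) :
    Integrable (fun x => ‖fderiv ℝ u x‖ ^ 2) := by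
  have hc : Continuous (fun x => ‖fderiv ℝ u x‖ ^ 2) :=
    (hu.1.continuous_fderiv (by simp)).norm.pow 2
  refine hc.integrable_of_hasCompactSupport ((hu.2.1.fderiv ℝ).mono fun x hx => ?_)
  contrapose! hx
  simp_all

/-- A smooth test function is square integrable. -/
theorem IsTest.integrable_sq {N : ℕ} {Ω : Set (EuclideanSpace ℝ (Fin N))}
    {u : EuclideanSpace ℝ (Fin N) → ℝ} (hu : IsTest N Ω u) :
    Integrable (fun x => u x ^ 2) := by
  have hc : Continuous (fun x => u x ^ 2) := hu.1.continuous.pow 2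
  refine hc.integrable_of_hasCompactSupport (hu.2.1.mono fun x hx => ?_)
  contrapose! hx
  simp_all

/-- Cutting off by `1 - χ` maps test functions to test functions. -/
theorem IsTest.one_sub_mul {N : ℕ} {Ω : Set (EuclideanSpace ℝ (Fin N))}
    {χ u : EuclideanSpace ℝ (Fin N) → ℝ} (hχ : ContDiff ℝ (⊤ : ℕ∞) χ) (hu : IsTest N Ω u) :
    IsTest N Ω (fun x => (1 - χ x) * u x) :=
  ⟨(contDiff_const.sub hχ).mul hu.1, hu.2.1.mul_left,
    (tsupport_mul_subset_right (f := fun x => 1 - χ x)).trans hu.2.2⟩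

/-- Young's inequality for the square of a sum, with a parameter. -/
theorem add_sq_le_one_add_mul_sq {δ : ℝ} (hδ : 0 < δ) (a b : ℝ) :
    (a + b) ^ 2 ≤ (1 + δ) * a ^ 2 + (1 + δ⁻¹) * b ^ 2 := by
  have h : (1 + δ) * a ^ 2 + (1 + δ⁻¹) * b ^ 2 - (a + b) ^ 2 = δ⁻¹ * (δ * a - b) ^ 2 := by
    field_simp
    ring
  have : 0 ≤ δ⁻¹ * (δ * a - b) ^ 2 := by positivity
  linarith

/-- The gradient of `(1 - χ) u` is pointwise bounded by those of `u` and `χ`. -/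
theorem norm_fderiv_one_sub_mul_le {E : Type*} [NormedAddCommGroup E] [NormedSpace ℝ E]
    {χ u : E → ℝ} {x : E} (hχ : DifferentiableAt ℝ χ x) (hu : DifferentiableAt ℝ u x)
    (hχ01 : χ x ∈ Set.Icc (0 : ℝ) 1) :
    ‖fderiv ℝ (fun y => (1 - χ y) * u y) x‖ ≤ ‖fderiv ℝ u x‖ + |u x| * ‖fderiv ℝ χ x‖ := by
  have h : fderiv ℝ (fun y => (1 - χ y) * u y) x =
      (1 - χ x) • fderiv ℝ u x - u x • fderiv ℝ χ x := by
    rw [fderiv_fun_mul (hχ.const_sub 1) hu, fderiv_const_sub, smul_neg, ← sub_eq_add_neg]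
  rw [h]
  refine (norm_sub_le _ _).trans ?_
  rw [norm_smul, norm_smul, Real.norm_eq_abs, Real.norm_eq_abs,
    abs_of_nonneg (sub_nonneg.2 hχ01.2)]
  gcongr
  exact mul_le_of_le_one_left (norm_nonneg _) (by linarith [hχ01.1])

/-- The energy of `(1 - χ) u` exceeds that of `u` by at most a small multiple of the energy of
`u` plus a multiple of the mass of `u` on the support of `χ`. -/
theorem IsTest.grad2_one_sub_mul_le {N : ℕ} {Ω : Set (EuclideanSpace ℝ (Fin N))}
    {χ u : EuclideanSpace ℝ (Fin N) → ℝ} (hχ : ContDiff ℝ (⊤ : ℕ∞) χ)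
    (hχ01 : ∀ x, χ x ∈ Set.Icc (0 : ℝ) 1) {M : ℝ} (hM : ∀ x, ‖fderiv ℝ χ x‖ ≤ M)
    (hu : IsTest N Ω u) {δ : ℝ} (hδ : 0 < δ) :
    grad2 N (fun x => (1 - χ x) * u x) ≤
      (1 + δ) * grad2 N u + (1 + δ⁻¹) * M ^ 2 * ∫ x in tsupport χ, u x ^ 2 := by
  have hmeas : MeasurableSet (tsupport χ) := (isClosed_tsupport χ).measurableSet
  have hi := hu.integrable_sq_norm_fderiv.const_mul (1 + δ)
  have hj := (hu.integrable_sq.indicator hmeas).const_mul ((1 + δ⁻¹) * M ^ 2)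
  rw [grad2, grad2, ← integral_indicator hmeas, ← integral_const_mul, ← integral_const_mul,
    ← integral_add hi hj]
  refine integral_mono (hu.one_sub_mul hχ).integrable_sq_norm_fderiv (hi.add hj) fun x => ?_
  have hle := norm_fderiv_one_sub_mul_le (hχ.differentiable (by simp) x)
    (hu.1.differentiable (by simp) x) (hχ01 x)
  refine (pow_le_pow_left₀ (norm_nonneg _) hle 2).trans
    ((add_sq_le_one_add_mul_sq hδ _ _).trans ?_)
  refine add_le_add_right ?_ _
  rw [mul_assoc]
  refine mul_le_mul_of_nonneg_left ?_ (by positivity)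
  by_cases hx : x ∈ tsupport χ
  · rw [Set.indicator_of_mem hx, mul_pow, sq_abs, mul_comm]
    gcongr
    exact hM x
  · have h0 : fderiv ℝ χ x = 0 :=
      image_eq_zero_of_notMem_tsupport fun h => hx (tsupport_fderiv_subset ℝ h)
    simp [hx, h0]

/-- **Inequality (2.8) of Pinchover–Tintarev.** If `v_k` are supported in `Ω ∪ B`, have
bounded Dirichlet energy, and their mass on `supp χ` vanishes, then
`liminf (∫|∇v_k|² − ∫|∇((1−χ)v_k)|²) ≥ 0` (stated via: for every `ε > 0`, eventually
`∫|∇v_k|² − ∫|∇((1−χ)v_k)|² > −ε`). -/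
theorem cutoff_almost_decreases_energy
    (N : ℕ) (hN : 3 ≤ N)
    (Ω B : Set (EuclideanSpace ℝ (Fin N))) (hΩop : IsOpen Ω) (hBop : IsOpen B)
    (hBbd : Bornology.IsBounded B)
    (χ : EuclideanSpace ℝ (Fin N) → ℝ) (hχsm : ContDiff ℝ (⊤ : ℕ∞) χ)
    (hχcs : HasCompactSupport χ)
    (hχ01 : ∀ x, χ x ∈ Set.Icc (0 : ℝ) 1) (hχB : ∀ x ∈ closure B, χ x = 1)
    (v : ℕ → EuclideanSpace ℝ (Fin N) → ℝ) (hv : ∀ k, IsTest N (Ω ∪ B) (v k))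
    (hbd : ∃ C : ℝ, ∀ k, grad2 N (v k) ≤ C)
    (hvanish : Tendsto (fun k => ∫ x in tsupport χ, (v k x) ^ 2) atTop (𝓝 0)) :
    ∀ ε : ℝ, 0 < ε → ∀ᶠ k in atTop,
      -ε < grad2 N (v k) - grad2 N (fun x => (1 - χ x) * v k x) := by
  intro ε hε
  obtain ⟨C, hC⟩ := hbd
  obtain ⟨M, hM⟩ := (hχsm.continuous_fderiv (by simp)).bounded_above_of_compact_support
    (hχcs.fderiv ℝ)
  set δ : ℝ := ε / (2 * (|C| + 1)) with hδdef
  have hδ : 0 < δ := by positivity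
  have hlim := hvanish.const_mul ((1 + δ⁻¹) * M ^ 2)
  rw [mul_zero] at hlim
  filter_upwards [hlim.eventually_lt_const (half_pos hε)] with k hk
  have hle := (hv k).grad2_one_sub_mul_le hχsm hχ01 hM hδ
  have hsmall : δ * grad2 N (v k) ≤ ε / 2 := calc
    δ * grad2 N (v k) ≤ δ * (|C| + 1) := by
      gcongr
      linarith [hC k, le_abs_self C]
    _ = ε / 2 := by
      rw [hδdef]
      field_simp
  linarith
end

section
/- Let N ≥ 3, let Ω ⊂ ℝ^N be a nonempty bounded open set, let p > N/2, and let V : ℝ^N → ℝ be nonnegative with V ∈ L^p(Ω), such that there exists a smooth function u₀ with compact support contained in Ω with ∫ V u₀² > 0. Then every normalized minimizing sequence for μ_Ω has a subsequence (u_{k_j}) whose gradients (∇u_{k_j}) form a Cauchy sequence in L²(ℝ^N; ℝ^N); in particular the infimum μ_Ω is attained in the completion D^{1,2}(Ω). -/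
open MeasureTheory Filter Topology

open scoped ENNReal NNReal

theorem exists_subseq_tendsto_setIntegral {X : Type*} [MeasurableSpace X]
    [MeasurableSpace.CountablyGenerated X] {μ : Measure X} [SFinite μ] {f : ℕ → X → ℝ}
    (hf : ∀ k, MemLp (f k) 2 μ) {C : ℝ≥0} (hC : ∀ k, eLpNorm (f k) 2 μ ≤ C) :
    ∃ φ : ℕ → ℕ, StrictMono φ ∧ ∀ s, MeasurableSet s → μ s ≠ ∞ →
      ∃ l, Tendsto (fun k => ∫ x in s, f (φ k) x ∂μ) atTop (𝓝 l) := by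
  have : Fact ((2 : ℝ≥0∞) ≠ ∞) := ⟨by simp⟩
  let F : ℕ → WeakDual ℝ (Lp ℝ 2 μ) := fun k =>
    StrongDual.toWeakDual (InnerProductSpace.toDual ℝ (Lp ℝ 2 μ) ((hf k).toLp (f k)))
  obtain ⟨a, -, φ, hφ, ha⟩ := WeakDual.isSeqCompact_closedBall ℝ (Lp ℝ 2 μ) 0 C
    (x := F) (fun k => by
      simp only [F, Set.mem_preimage, mem_closedBall_zero_iff]
      change ‖InnerProductSpace.toDual ℝ (Lp ℝ 2 μ) ((hf k).toLp (f k))‖ ≤ C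
      rw [LinearIsometryEquiv.norm_map, Lp.norm_toLp]
      exact ENNReal.toReal_le_coe_of_le_coe (hC k))
  refine ⟨φ, hφ, fun s hs hμs => ⟨a (indicatorConstLp 2 hs hμs 1), ?_⟩⟩
  refine (((WeakDual.eval_continuous (indicatorConstLp 2 hs hμs (1 : ℝ))).tendsto a).comp
    ha).congr fun k => ?_
  change inner ℝ ((hf (φ k)).toLp (f (φ k))) (indicatorConstLp 2 hs hμs (1 : ℝ)) = _
  rw [real_inner_comm, L2.inner_indicatorConstLp_one]
  exact setIntegral_congr_ae hs ((hf (φ k)).coeFn_toLp.mono fun x hx _ => hx)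

theorem lintegral_enorm_le_of_support_subset {X F : Type*} [MeasurableSpace X]
    [NormedAddCommGroup F] {μ : Measure X} {s : Set X} {f : X → F}
    (hf : AEStronglyMeasurable f μ) (hs : f.support ⊆ s) {C : ℝ≥0∞} (hC : eLpNorm f 2 μ ≤ C) :
    ∫⁻ x, ‖f x‖ₑ ∂μ ≤ C * μ s ^ (1 / 2 : ℝ) := by
  rw [← eLpNorm_one_eq_lintegral_enorm, ← eLpNorm_restrict_eq_of_support_subset hs]
  refine (eLpNorm_le_eLpNorm_mul_rpow_measure_univ (q := 2) (by norm_num) hf.restrict).trans ?_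
  rw [eLpNorm_restrict_eq_of_support_subset hs, Measure.restrict_apply_univ]
  exact mul_le_mul' hC (le_of_eq (by norm_num))

section Rellich
variable {E : Type*} [NormedAddCommGroup E] [MeasurableSpace E] (μ : Measure E)

/-- The mean of `w` over the ball of radius `r` around `x`. -/
noncomputable def ballMean (r : ℝ) (w : E → ℝ) (x : E) : ℝ :=
  ⨍ h in Metric.ball 0 r, w (x + h) ∂μ

variable [BorelSpace E] [μ.IsAddHaarMeasure]

theorem ballMean_eq (r : ℝ) (w : E → ℝ) (x : E) :
    ballMean μ r w x = (μ.real (Metric.ball (0 : E) r))⁻¹ * ∫ y in Metric.ball x r, w y ∂μ := by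
  simp only [ballMean, setAverage_eq, smul_eq_mul]
  congr 1
  have := (measurePreserving_add_left μ x).setIntegral_preimage_emb
    (MeasurableEquiv.addLeft x).measurableEmbedding w (Metric.ball x r)
  rw [← this]
  congr 2
  ext; simp [dist_eq_norm]

theorem enorm_ballMean_le (r : ℝ) (w : E → ℝ) (x : E) :
    ‖ballMean μ r w x‖ₑ ≤ (μ (Metric.ball (0 : E) r))⁻¹ * ∫⁻ y, ‖w y‖ₑ ∂μ := by
  refine (enorm_integral_le_lintegral_enorm _).trans ?_
  rw [lintegral_smul_measure, Measure.restrict_apply_univ, smul_eq_mul]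
  refine mul_le_mul_right ?_ _
  refine (setLIntegral_le_lintegral _ _).trans_eq ?_
  exact lintegral_add_left_eq_self (fun y => ‖w y‖ₑ) x

variable [NormedSpace ℝ E] [FiniteDimensional ℝ E]

theorem lintegral_enorm_translate_sub_le {w : E → ℝ} (hw : ContDiff ℝ 1 w) (h : E) :
    ∫⁻ x, ‖w (x + h) - w x‖ₑ ∂μ ≤ ‖h‖ₑ * ∫⁻ x, ‖fderiv ℝ w x‖ₑ ∂μ := by
  have hc : Continuous (fderiv ℝ w) := hw.continuous_fderiv one_ne_zero
  have key : ∀ x, ‖w (x + h) - w x‖ₑ ≤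
      ∫⁻ t in Set.Ioc (0 : ℝ) 1, ‖fderiv ℝ w (x + t • h)‖ₑ * ‖h‖ₑ := by
    intro x
    have hd : ∀ t ∈ Set.uIcc (0 : ℝ) 1,
        HasDerivAt (fun t : ℝ => w (x + t • h)) (fderiv ℝ w (x + t • h) h) t := by
      intro t _
      have h1 : HasDerivAt (fun t : ℝ => x + t • h) h t := by
        simpa using ((hasDerivAt_id t).smul_const h).const_add x
      exact ((hw.differentiable one_ne_zero _).hasFDerivAt).comp_hasDerivAt t h1
    have := intervalIntegral.integral_eq_sub_of_hasDerivAt hd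
      (Continuous.intervalIntegrable (by fun_prop) _ _)
    simp only [one_smul, zero_smul, add_zero] at this
    rw [← this, intervalIntegral.integral_of_le zero_le_one]
    refine (enorm_integral_le_lintegral_enorm _).trans (lintegral_mono fun t => ?_)
    exact ContinuousLinearMap.le_opENorm _ _
  calc ∫⁻ x, ‖w (x + h) - w x‖ₑ ∂μ
      ≤ ∫⁻ x, (∫⁻ t in Set.Ioc (0 : ℝ) 1, ‖fderiv ℝ w (x + t • h)‖ₑ * ‖h‖ₑ) ∂μ :=
        lintegral_mono key
    _ = ∫⁻ t in Set.Ioc (0 : ℝ) 1, ∫⁻ x, ‖fderiv ℝ w (x + t • h)‖ₑ * ‖h‖ₑ ∂μ := by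
        refine lintegral_lintegral_swap ?_
        have : Continuous fun p : E × ℝ => ‖fderiv ℝ w (p.1 + p.2 • h)‖ₑ * ‖h‖ₑ := by
          refine ENNReal.continuous_mul_const (by simp) |>.comp ?_
          fun_prop
        exact this.measurable.aemeasurable
    _ = ∫⁻ t in Set.Ioc (0 : ℝ) 1, ‖h‖ₑ * ∫⁻ x, ‖fderiv ℝ w x‖ₑ ∂μ := by
        congr 1 with t
        rw [lintegral_mul_const' _ _ (by simp), mul_comm,
          lintegral_add_right_eq_self (fun x => ‖fderiv ℝ w x‖ₑ) (t • h)]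
    _ = ‖h‖ₑ * ∫⁻ x, ‖fderiv ℝ w x‖ₑ ∂μ := by simp

theorem integrableOn_ball_comp_add {w : E → ℝ} (hw : Continuous w) (x : E) (r : ℝ) :
    IntegrableOn (fun h => w (x + h)) (Metric.ball 0 r) μ :=
  ((hw.comp (continuous_const.add continuous_id)).continuousOn.integrableOn_compact
    (isCompact_closedBall (0 : E) r)).mono_set Metric.ball_subset_closedBall

theorem measurable_ballMean (r : ℝ) {w : E → ℝ} (hw : Continuous w) :
    Measurable (ballMean μ r w) := by
  have h : Continuous (Function.uncurry fun x h : E => w (x + h)) := by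
    simp only [Function.uncurry_def]; fun_prop
  exact (h.stronglyMeasurable.integral_prod_right
    (ν := ((μ.restrict (Metric.ball 0 r)) Set.univ)⁻¹ • μ.restrict (Metric.ball 0 r))).measurable

theorem ballMean_sub (r : ℝ) {v w : E → ℝ} (hv : Continuous v) (hw : Continuous w) (x : E) :
    ballMean μ r (fun y => v y - w y) x = ballMean μ r v x - ballMean μ r w x := by
  simp only [ballMean, setAverage_eq, smul_eq_mul]
  rw [integral_sub (integrableOn_ball_comp_add μ hv x r) (integrableOn_ball_comp_add μ hw x r),
    mul_sub]

theorem lintegral_enorm_sub_ballMean_le {r : ℝ} (hr : 0 < r) {w : E → ℝ} (hw : ContDiff ℝ 1 w) :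
    ∫⁻ x, ‖w x - ballMean μ r w x‖ₑ ∂μ ≤ ENNReal.ofReal r * ∫⁻ x, ‖fderiv ℝ w x‖ₑ ∂μ := by
  have hwc := hw.continuous
  set B : Set E := Metric.ball 0 r with hB
  have hB0 : μ B ≠ 0 := (Metric.measure_ball_pos μ 0 hr).ne'
  have hBt : μ B ≠ ∞ := measure_ball_lt_top.ne
  have key : ∀ x, ‖w x - ballMean μ r w x‖ₑ ≤ (μ B)⁻¹ * ∫⁻ h in B, ‖w (x + h) - w x‖ₑ ∂μ := by
    intro x
    have h1 : ballMean μ r w x - w x = ⨍ h in B, (w (x + h) - w x) ∂μ := by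
      simp only [ballMean, setAverage_eq, smul_eq_mul]
      rw [integral_sub (integrableOn_ball_comp_add μ hwc x r) (integrableOn_const hBt),
        mul_sub, ← hB]
      simp only [integral_const, measureReal_restrict_apply_univ, smul_eq_mul]
      rw [inv_mul_cancel_left₀]
      exact (ENNReal.toReal_pos hB0 hBt).ne'
    rw [← enorm_neg, neg_sub, h1]
    refine (enorm_integral_le_lintegral_enorm _).trans ?_
    rw [lintegral_smul_measure, Measure.restrict_apply_univ, smul_eq_mul]
  calc ∫⁻ x, ‖w x - ballMean μ r w x‖ₑ ∂μ
      ≤ ∫⁻ x, (μ B)⁻¹ * ∫⁻ h in B, ‖w (x + h) - w x‖ₑ ∂μ ∂μ := lintegral_mono key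
    _ = (μ B)⁻¹ * ∫⁻ h in B, ∫⁻ x, ‖w (x + h) - w x‖ₑ ∂μ ∂μ := by
        rw [lintegral_const_mul' _ _ (by simpa using hB0), lintegral_lintegral_swap]
        have : Continuous fun p : E × E => ‖w (p.1 + p.2) - w p.1‖ₑ := by fun_prop
        exact this.measurable.aemeasurable
    _ ≤ (μ B)⁻¹ * ∫⁻ h in B, ENNReal.ofReal r * ∫⁻ x, ‖fderiv ℝ w x‖ₑ ∂μ ∂μ := by
        refine mul_le_mul_right ?_ _
        refine setLIntegral_mono' measurableSet_ball fun h hh => ?_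
        refine (lintegral_enorm_translate_sub_le μ hw h).trans ?_
        gcongr
        rw [← ofReal_norm]
        exact ENNReal.ofReal_le_ofReal (by simpa [hB] using (le_of_lt (mem_ball_zero_iff.1 hh)))
    _ = _ := by
        rw [setLIntegral_const, mul_comm, mul_assoc, ENNReal.mul_inv_cancel hB0 hBt, mul_one]

/-- Rellich compactness: a sequence bounded in `H¹` and supported in a fixed bounded set has a
subsequence that is Cauchy in `L¹`. -/
theorem exists_subseq_tendsto_lintegral_enorm_sub {Ω : Set E} (hΩ : MeasurableSet Ω)
    (hb : Bornology.IsBounded Ω) {u : ℕ → E → ℝ} (hu : ∀ k, ContDiff ℝ 1 (u k))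
    (hs : ∀ k, tsupport (u k) ⊆ Ω) {C : ℝ≥0} (h0 : ∀ k, eLpNorm (u k) 2 μ ≤ C)
    (h1 : ∀ k, eLpNorm (fderiv ℝ (u k)) 2 μ ≤ C) :
    ∃ φ : ℕ → ℕ, StrictMono φ ∧
      Tendsto (fun q : ℕ × ℕ => ∫⁻ x, ‖u (φ q.1) x - u (φ q.2) x‖ₑ ∂μ) atTop (𝓝 0) := by
  have hμΩ : μ Ω ≠ ∞ := hb.measure_lt_top.ne
  have hc : ∀ k, Continuous (u k) := fun k => (hu k).continuous
  obtain ⟨φ, hφ, hlim⟩ := exists_subseq_tendsto_setIntegral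
    (fun k => ⟨(hc k).aestronglyMeasurable, (h0 k).trans_lt ENNReal.coe_lt_top⟩) h0
  refine ⟨φ, hφ, ?_⟩
  set K : ℝ≥0∞ := C * μ Ω ^ (1 / 2 : ℝ) with hK
  have hKt : K ≠ ∞ := ENNReal.mul_ne_top ENNReal.coe_ne_top
    (ENNReal.rpow_ne_top_of_nonneg (by norm_num) hμΩ)
  have hK0 : ∀ k, ∫⁻ x, ‖u k x‖ₑ ∂μ ≤ K := fun k =>
    lintegral_enorm_le_of_support_subset (hc k).aestronglyMeasurable
      ((subset_tsupport _).trans (hs k)) (h0 k)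
  have hK1 : ∀ k, ∫⁻ x, ‖fderiv ℝ (u k) x‖ₑ ∂μ ≤ K := fun k =>
    lintegral_enorm_le_of_support_subset
      ((hu k).continuous_fderiv one_ne_zero).aestronglyMeasurable
      ((support_fderiv_subset ℝ).trans (hs k)) (h1 k)
  -- convergence of the means
  have hmean : ∀ r : ℝ, 0 < r → Tendsto (fun q : ℕ × ℕ =>
      ∫⁻ x in Ω, ‖ballMean μ r (fun y => u (φ q.1) y - u (φ q.2) y) x‖ₑ ∂μ) atTop (𝓝 0) := by
    intro r hr
    set b : ℝ≥0∞ := (μ (Metric.ball (0 : E) r))⁻¹ with hbdef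
    have hbt : b ≠ ∞ := by
      simpa [hbdef] using (Metric.measure_ball_pos μ (0 : E) hr).ne'
    have := tendsto_lintegral_filter_of_dominated_convergence (μ := μ.restrict Ω)
      (l := (atTop : Filter (ℕ × ℕ)))
      (F := fun q x => ‖ballMean μ r (fun y => u (φ q.1) y - u (φ q.2) y) x‖ₑ)
      (f := fun _ => 0) (fun _ => b * (K + K)) (Eventually.of_forall fun q =>
        (measurable_ballMean μ r ((hc _).sub (hc _))).enorm)
      (Eventually.of_forall fun q => Eventually.of_forall fun x => ?_) ?_
      (Eventually.of_forall fun x => ?_)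
    · simpa using this
    · refine (enorm_ballMean_le μ r _ x).trans (mul_le_mul_right ?_ _)
      refine (lintegral_mono fun y => enorm_sub_le).trans ?_
      rw [lintegral_add_left (hc _).enorm.measurable]
      exact add_le_add (hK0 _) (hK0 _)
    · rw [lintegral_const, Measure.restrict_apply_univ]
      exact ENNReal.mul_ne_top (ENNReal.mul_ne_top hbt (by simp [hKt])) hμΩ
    · obtain ⟨l, hl⟩ := hlim (Metric.ball x r) measurableSet_ball measure_ball_lt_top.ne
      have hl' : Tendsto (fun k => ballMean μ r (u (φ k)) x) atTop
          (𝓝 ((μ.real (Metric.ball (0 : E) r))⁻¹ * l)) := by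
        simp_rw [ballMean_eq]
        exact hl.const_mul _
      have h2 : Tendsto (fun q : ℕ × ℕ => ballMean μ r (u (φ q.1)) x - ballMean μ r (u (φ q.2)) x)
          atTop (𝓝 0) := by
        rw [← prod_atTop_atTop_eq]
        simpa using (hl'.comp tendsto_fst).sub (hl'.comp tendsto_snd)
      have h3 := h2.enorm
      simp_rw [ballMean_sub μ r (hc _) (hc _)]
      simpa using h3
  rw [ENNReal.tendsto_nhds_zero]
  intro δ hδ
  obtain ⟨r, hr, hrδ⟩ : ∃ r : ℝ, 0 < r ∧ ENNReal.ofReal r * (K + K) ≤ δ / 2 := by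
    have : Tendsto (fun r : ℝ => ENNReal.ofReal r * (K + K)) (𝓝[>] 0) (𝓝 0) := by
      have h : Tendsto (fun r : ℝ => ENNReal.ofReal r * (K + K)) (𝓝 0)
          (𝓝 (ENNReal.ofReal 0 * (K + K))) :=
        ENNReal.Tendsto.mul_const (ENNReal.tendsto_ofReal tendsto_id) (Or.inr (by simp [hKt]))
      simpa using h.mono_left nhdsWithin_le_nhds
    obtain ⟨r, h, hr⟩ := (((ENNReal.tendsto_nhds_zero.1 this) (δ / 2)
      (ENNReal.half_pos hδ.ne')).and self_mem_nhdsWithin).exists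
    exact ⟨r, hr, h⟩
  filter_upwards [ENNReal.tendsto_nhds_zero.1 (hmean r hr) (δ / 2) (ENNReal.half_pos hδ.ne')]
    with q hq
  set w : E → ℝ := fun y => u (φ q.1) y - u (φ q.2) y with hw
  have hwd : ContDiff ℝ 1 w := (hu _).sub (hu _)
  have hsupp : Function.support (fun x => ‖w x‖ₑ) ⊆ Ω := by
    intro x hx
    by_contra hxΩ
    have hz : ∀ k, u k x = 0 := fun k => image_eq_zero_of_notMem_tsupport fun h => hxΩ (hs k h)
    simp [hw, hz] at hx
  calc ∫⁻ x, ‖w x‖ₑ ∂μ = ∫⁻ x in Ω, ‖w x‖ₑ ∂μ := by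
        rw [← lintegral_indicator hΩ, Set.indicator_eq_self.2 hsupp]
    _ ≤ ∫⁻ x in Ω, (‖w x - ballMean μ r w x‖ₑ + ‖ballMean μ r w x‖ₑ) ∂μ :=
        lintegral_mono fun x => by
          simpa using enorm_add_le (w x - ballMean μ r w x) (ballMean μ r w x)
    _ = ∫⁻ x in Ω, ‖w x - ballMean μ r w x‖ₑ ∂μ + ∫⁻ x in Ω, ‖ballMean μ r w x‖ₑ ∂μ :=
        lintegral_add_right _ (measurable_ballMean μ r hwd.continuous).enorm
    _ ≤ δ / 2 + δ / 2 := by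
        refine add_le_add (((setLIntegral_le_lintegral _ _).trans
          (lintegral_enorm_sub_ballMean_le μ hr hwd)).trans (le_trans ?_ hrδ)) hq
        refine mul_le_mul_right ?_ _
        have hfd : ∀ x, fderiv ℝ w x = fderiv ℝ (u (φ q.1)) x - fderiv ℝ (u (φ q.2)) x := fun x =>
          fderiv_fun_sub ((hu _).differentiable one_ne_zero x) ((hu _).differentiable one_ne_zero x)
        simp_rw [hfd]
        refine (lintegral_mono fun y => enorm_sub_le).trans ?_
        rw [lintegral_add_left ((hu _).continuous_fderiv one_ne_zero).enorm.measurable]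
        exact add_le_add (hK1 _) (hK1 _)
    _ = δ := ENNReal.add_halves δ
end Rellich

theorem exists_mul_sq_le {p r : ℝ} (hp : 1 < p) (hr : 2 * (p / (p - 1)) < r) {η : ℝ} (hη : 0 < η) :
    ∃ A : ℝ, 0 ≤ A ∧ ∀ v s : ℝ, 0 ≤ v → 0 ≤ s → v * s ^ 2 ≤ η * v ^ p + η * s ^ r + A * s := by
  set q := p / (p - 1) with hq
  have hpq : p.HolderConjugate q := Real.HolderConjugate.conjExponent hp
  have hq1 : 1 < q := hpq.symm.lt
  set κ : ℝ := η ^ (1 / p) with hκ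
  have hκ0 : 0 < κ := Real.rpow_pos_of_pos hη _
  have hκp : κ ^ p = η := by
    rw [hκ, ← Real.rpow_mul hη.le, one_div_mul_cancel (by linarith), Real.rpow_one]
  set C : ℝ := κ⁻¹ ^ q with hC
  have hC0 : 0 < C := Real.rpow_pos_of_pos (inv_pos.2 hκ0) _
  set L : ℝ := (C / η) ^ (1 / (r - 2 * q)) with hL
  have hL0 : 0 < L := Real.rpow_pos_of_pos (div_pos hC0 hη) _
  have hLr : C * L ^ (2 * q - r) = η := by
    rw [hL, ← Real.rpow_mul (div_pos hC0 hη).le,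
      show 1 / (r - 2 * q) * (2 * q - r) = -1 by
        have : r - 2 * q ≠ 0 := by linarith
        field_simp
        ring,
      Real.rpow_neg_one]
    field_simp
  refine ⟨C * L ^ (2 * q - 1), by positivity, fun v s hv hs => ?_⟩
  have hyoung : v * s ^ 2 ≤ η * v ^ p + C * s ^ (2 * q) := by
    have h := Real.young_inequality_of_nonneg (a := κ * v) (b := κ⁻¹ * s ^ 2) (by positivity)
      (by positivity) hpq
    rw [show κ * v * (κ⁻¹ * s ^ 2) = v * s ^ 2 by field_simp, Real.mul_rpow hκ0.le hv, hκp,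
      Real.mul_rpow (inv_pos.2 hκ0).le (by positivity), ← Real.rpow_natCast s 2,
      ← Real.rpow_mul hs, Nat.cast_ofNat] at h
    have h1 : η * v ^ p / p ≤ η * v ^ p := div_le_self (by positivity) hp.le
    have h2 : κ⁻¹ ^ q * s ^ (2 * q) / q ≤ C * s ^ (2 * q) := div_le_self (by positivity) hq1.le
    rw [← Real.rpow_natCast s 2, Nat.cast_ofNat]
    linarith
  have hsplit : C * s ^ (2 * q) ≤ η * s ^ r + C * L ^ (2 * q - 1) * s := by
    rcases hs.eq_or_lt with rfl | hs0
    · rw [Real.zero_rpow (by linarith), Real.zero_rpow (by linarith)]; simp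
    rcases le_total s L with h | h
    · have h1 : s ^ (2 * q) = s ^ (2 * q - 1) * s := by
        rw [← Real.rpow_add_one hs0.ne']; ring_nf
      have h2 : s ^ (2 * q - 1) ≤ L ^ (2 * q - 1) := Real.rpow_le_rpow hs h (by linarith)
      have h3 : 0 ≤ η * s ^ r := by positivity
      rw [h1, ← mul_assoc]
      have : C * s ^ (2 * q - 1) * s ≤ C * L ^ (2 * q - 1) * s := by gcongr
      linarith
    · have h1 : s ^ (2 * q) = s ^ (2 * q - r) * s ^ r := by
        rw [← Real.rpow_add hs0]; ring_nf
      have h2 : s ^ (2 * q - r) ≤ L ^ (2 * q - r) :=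
        Real.rpow_le_rpow_of_nonpos hL0 h (by linarith)
      have h3 : 0 ≤ C * L ^ (2 * q - 1) * s := by positivity
      have : C * (s ^ (2 * q - r) * s ^ r) ≤ C * L ^ (2 * q - r) * s ^ r := by
        rw [← mul_assoc]; gcongr
      rw [h1]
      rw [hLr] at this
      linarith
  linarith

section Test
variable {N : ℕ} {Ω : Set (EuclideanSpace ℝ (Fin N))} {u v V : EuclideanSpace ℝ (Fin N) → ℝ}

theorem IsTest.contDiff_one (hu : IsTest N Ω u) : ContDiff ℝ 1 u :=
  hu.1.of_le (by exact_mod_cast le_top)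

theorem IsTest.add (hu : IsTest N Ω u) (hv : IsTest N Ω v) : IsTest N Ω (fun x => u x + v x) :=
  ⟨hu.1.add hv.1, hu.2.1.add hv.2.1, (tsupport_add u v).trans (Set.union_subset hu.2.2 hv.2.2)⟩

theorem IsTest.sub (hu : IsTest N Ω u) (hv : IsTest N Ω v) : IsTest N Ω (fun x => u x - v x) :=
  ⟨hu.1.sub hv.1, hu.2.1.sub hv.2.1, (tsupport_sub u v).trans (Set.union_subset hu.2.2 hv.2.2)⟩

theorem IsTest.eq_zero (hu : IsTest N Ω u) {x : EuclideanSpace ℝ (Fin N)} (hx : x ∉ Ω) :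
    u x = 0 :=
  image_eq_zero_of_notMem_tsupport fun h => hx (hu.2.2 h)

theorem IsTest.continuous_fderiv (hu : IsTest N Ω u) : Continuous (fderiv ℝ u) :=
  hu.contDiff_one.continuous_fderiv one_ne_zero

theorem IsTest.integrable_abs_rpow (hu : IsTest N Ω u) {r : ℝ} (hr : 0 < r) :
    Integrable (fun x => |u x| ^ r) := by
  refine Continuous.integrable_of_hasCompactSupport
    (hu.contDiff_one.continuous.abs.rpow_const fun _ => Or.inr hr.le) ?_
  exact hu.2.1.comp_left (g := fun t : ℝ => |t| ^ r) (by simp [Real.zero_rpow hr.ne'])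

theorem IsTest.integrable_abs (hu : IsTest N Ω u) : Integrable (fun x => |u x|) := by
  simpa using hu.integrable_abs_rpow one_pos

theorem IsTest.integrable_norm_fderiv_sq (hu : IsTest N Ω u) :
    Integrable (fun x => ‖fderiv ℝ u x‖ ^ 2) :=
  (hu.continuous_fderiv.norm.pow 2).integrable_of_hasCompactSupport <|
    HasCompactSupport.intro (hu.2.1.fderiv ℝ) fun x hx => by
      simp [image_eq_zero_of_notMem_tsupport hx]

theorem ven_nonneg (hV : ∀ x, 0 ≤ V x) : 0 ≤ ven N V u :=
  integral_nonneg fun x => mul_nonneg (hV x) (sq_nonneg _)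

theorem grad2_nonneg : 0 ≤ grad2 N u :=
  integral_nonneg fun _ => sq_nonneg _

theorem mu_mul_ven_le (hV : ∀ x, 0 ≤ V x) (hu : IsTest N Ω u) :
    mu N V Ω * ven N V u ≤ grad2 N u := by
  rcases (ven_nonneg hV : 0 ≤ ven N V u).eq_or_lt with h | h
  · rw [← h, mul_zero]; exact grad2_nonneg
  · rw [← le_div_iff₀ h]
    refine csInf_le ⟨0, ?_⟩ ⟨u, hu, h, rfl⟩
    rintro _ ⟨w, -, hw, rfl⟩
    exact div_nonneg grad2_nonneg hw.le

theorem grad2_add_add_grad2_sub (hu : IsTest N Ω u) (hv : IsTest N Ω v) :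
    grad2 N (fun x => u x + v x) + grad2 N (fun x => u x - v x) =
      2 * grad2 N u + 2 * grad2 N v := by
  have hd : ∀ {w}, IsTest N Ω w → ∀ x, DifferentiableAt ℝ w x := fun hw =>
    hw.contDiff_one.differentiable one_ne_zero
  simp only [grad2]
  rw [← integral_add (hu.add hv).integrable_norm_fderiv_sq (hu.sub hv).integrable_norm_fderiv_sq,
    ← integral_const_mul, ← integral_const_mul,
    ← integral_add (hu.integrable_norm_fderiv_sq.const_mul 2)
      (hv.integrable_norm_fderiv_sq.const_mul 2)]
  congr 1 with x
  rw [fderiv_fun_add (hd hu x) (hd hv x), fderiv_fun_sub (hd hu x) (hd hv x)]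
  set e := (InnerProductSpace.toDual ℝ (EuclideanSpace ℝ (Fin N))).symm
  have h := parallelogram_law_with_norm ℝ (e (fderiv ℝ u x)) (e (fderiv ℝ v x))
  rw [← map_add, ← map_sub] at h
  simp only [LinearIsometryEquiv.norm_map] at h
  linarith

theorem aestronglyMeasurable_of_rpow {X : Type*} [MeasurableSpace X] {μ : Measure X} {f : X → ℝ}
    {p : ℝ} (hp : p ≠ 0) (hf : ∀ x, 0 ≤ f x) (h : AEStronglyMeasurable (fun x => f x ^ p) μ) :
    AEStronglyMeasurable f μ := by
  refine (h.aemeasurable.pow_const (1 / p)).aestronglyMeasurable.congr (ae_of_all _ fun x => ?_)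
  simp only
  rw [← Real.rpow_mul (hf x), mul_one_div_cancel hp, Real.rpow_one]

/-- Weighted integrability and the weighted interpolation inequality following from a pointwise
one. -/
theorem IsTest.integrable_mul_sq_and_ven_le {p r η A : ℝ} (hp : 0 < p)
    (hr : 0 < r) (hV : ∀ x, 0 ≤ V x)
    (hVp : IntegrableOn (fun x => V x ^ p) Ω)
    (hA : ∀ a s : ℝ, 0 ≤ a → 0 ≤ s → a * s ^ 2 ≤ η * a ^ p + η * s ^ r + A * s)
    (hu : IsTest N Ω u) :
    Integrable (fun x => V x * u x ^ 2) ∧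
      ven N V u ≤ η * (∫ x in Ω, V x ^ p) + η * (∫ x, |u x| ^ r) + A * ∫ x, |u x| := by
  have hir := hu.integrable_abs_rpow hr
  have hi1 := hu.integrable_abs
  have hbound : ∀ x, V x * u x ^ 2 ≤ η * V x ^ p + η * |u x| ^ r + A * |u x| := fun x => by
    simpa using hA (V x) |u x| (hV x) (abs_nonneg _)
  have hi2 : IntegrableOn (fun x => η * V x ^ p + η * |u x| ^ r) Ω :=
    (hVp.const_mul η).add (hir.const_mul η).integrableOn
  have hg : IntegrableOn (fun x => η * V x ^ p + η * |u x| ^ r + A * |u x|) Ω :=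
    hi2.add (hi1.const_mul A).integrableOn
  have hion : IntegrableOn (fun x => V x * u x ^ 2) Ω := by
    refine Integrable.mono' hg ((aestronglyMeasurable_of_rpow hp.ne' hV
      hVp.aestronglyMeasurable).mul
        (hu.contDiff_one.continuous.pow 2).aestronglyMeasurable) (ae_of_all _ fun x => ?_)
    rw [Real.norm_of_nonneg (mul_nonneg (hV x) (sq_nonneg _))]
    exact hbound x
  have hrestr : ∀ g : ℝ → ℝ, g 0 = 0 → ∫ x in Ω, g (u x) = ∫ x, g (u x) := fun g hg0 =>
    setIntegral_eq_integral_of_forall_compl_eq_zero fun x hx => by rw [hu.eq_zero hx, hg0]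
  have hz : ∀ x, x ∉ Ω → V x * u x ^ 2 = 0 := fun x hx => by simp [hu.eq_zero hx]
  refine ⟨(integrableOn_iff_integrable_of_support_subset fun x hx => ?_).1 hion, ?_⟩
  · by_contra h
    exact hx (hz x h)
  · rw [ven, ← setIntegral_eq_integral_of_forall_compl_eq_zero hz]
    refine (setIntegral_mono hion hg hbound).trans_eq ?_
    rw [integral_add hi2 (hi1.const_mul A).integrableOn,
      integral_add (hVp.const_mul η) (hir.const_mul η).integrableOn,
      integral_const_mul, integral_const_mul, integral_const_mul,
      hrestr (fun t => |t| ^ r) (by simp [Real.zero_rpow hr.ne']), hrestr (fun t => |t|) abs_zero]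

theorem ven_add_add_ven_sub (hu : Integrable (fun x => V x * u x ^ 2))
    (hv : Integrable (fun x => V x * v x ^ 2))
    (ha : Integrable (fun x => V x * (u x + v x) ^ 2))
    (hs : Integrable (fun x => V x * (u x - v x) ^ 2)) :
    ven N V (fun x => u x + v x) + ven N V (fun x => u x - v x) =
      2 * ven N V u + 2 * ven N V v := by
  simp only [ven]
  rw [← integral_add ha hs, ← integral_const_mul, ← integral_const_mul,
    ← integral_add (hu.const_mul 2) (hv.const_mul 2)]
  congr 1 with x
  ring

theorem IsTest.eLpNorm_fderiv_two (hu : IsTest N Ω u) :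
    eLpNorm (fderiv ℝ u) 2 volume = ENNReal.ofReal (grad2 N u ^ (1 / 2 : ℝ)) := by
  have hmem : MemLp (fderiv ℝ u) 2 volume :=
    hu.continuous_fderiv.memLp_of_hasCompactSupport (hu.2.1.fderiv ℝ)
  rw [hmem.eLpNorm_eq_integral_rpow_norm (by norm_num) (by norm_num)]
  simp [grad2]

theorem integral_abs_rpow_le {w : EuclideanSpace ℝ (Fin N) → ℝ} (hw : IsTest N Ω w)
    {r : ℝ≥0} (hr : 0 < r) {D : ℝ≥0} (hD : eLpNorm w r volume ≤ D) :
    ∫ x, |w x| ^ (r : ℝ) ≤ (D : ℝ) ^ (r : ℝ) := by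
  have hmem : MemLp w r volume := hw.contDiff_one.continuous.memLp_of_hasCompactSupport hw.2.1
  rw [hmem.eLpNorm_eq_integral_rpow_norm (by exact_mod_cast hr.ne') ENNReal.coe_ne_top] at hD
  simp only [ENNReal.coe_toReal, Real.norm_eq_abs] at hD
  have h0 : 0 ≤ ∫ x, |w x| ^ (r : ℝ) := integral_nonneg fun x => by positivity
  have hr' : (0 : ℝ) < r := hr
  rw [ENNReal.ofReal_le_iff_le_toReal ENNReal.coe_ne_top, ENNReal.coe_toReal] at hD
  calc ∫ x, |w x| ^ (r : ℝ) = ((∫ x, |w x| ^ (r : ℝ)) ^ (r : ℝ)⁻¹) ^ (r : ℝ) := by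
        rw [← Real.rpow_mul h0, inv_mul_cancel₀ hr'.ne', Real.rpow_one]
    _ ≤ (D : ℝ) ^ (r : ℝ) := Real.rpow_le_rpow (by positivity) hD hr'.le

/-- The weighted mass is compact with respect to the Dirichlet energy. -/
theorem exists_subseq_tendsto_ven_sub (hN : 3 ≤ N) (hΩop : IsOpen Ω)
    (hΩbd : Bornology.IsBounded Ω) {p : ℝ} (hp : (N : ℝ) / 2 < p) (hV0 : ∀ x, 0 ≤ V x)
    (hVp : IntegrableOn (fun x => V x ^ p) Ω) {u : ℕ → EuclideanSpace ℝ (Fin N) → ℝ}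
    (hu : ∀ k, IsTest N Ω (u k)) {G : ℝ} (hG : ∀ k, grad2 N (u k) ≤ G) :
    ∃ φ : ℕ → ℕ, StrictMono φ ∧ Tendsto
      (fun q : ℕ × ℕ => ven N V (fun x => u (φ q.1) x - u (φ q.2) x)) atTop (𝓝 0) := by
  have hN' : (3 : ℝ) ≤ N := by exact_mod_cast hN
  have hp1 : 1 < p := by linarith
  have hfin : Module.finrank ℝ (EuclideanSpace ℝ (Fin N)) = N := by simp
  set r : ℝ≥0 := 2 * N / (N - 2 : ℝ).toNNReal with hr
  have hrc : (r : ℝ) = 2 * N / (N - 2) := by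
    rw [hr]; push_cast; rw [Real.coe_toNNReal _ (by linarith)]
  have hr0 : (0 : ℝ) < r := by rw [hrc]; exact div_pos (by linarith) (by linarith)
  have hrp : 2 * (p / (p - 1)) < r := by
    rw [hrc, ← mul_div_assoc, div_lt_div_iff₀ (by linarith) (by linarith)]
    nlinarith
  set C₀ : ℝ≥0 := (G ^ (1 / 2 : ℝ)).toNNReal with hC₀
  have hgrad : ∀ k, eLpNorm (fderiv ℝ (u k)) (2 : ℝ≥0) volume ≤ C₀ := fun k => by
    rw [ENNReal.coe_ofNat, (hu k).eLpNorm_fderiv_two]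
    exact ENNReal.ofReal_le_ofReal (Real.rpow_le_rpow grad2_nonneg (hG k) (by norm_num))
  have hsob : ∀ q : ℝ≥0, (2 : ℝ)⁻¹ - (N : ℝ)⁻¹ ≤ (q : ℝ)⁻¹ →
      ∃ D : ℝ≥0, ∀ k, eLpNorm (u k) q volume ≤ D := by
    intro q hq
    refine ⟨eLpNormLESNormFDerivOfLeConst ℝ volume Ω 2 q * C₀, fun k => ?_⟩
    refine (eLpNorm_le_eLpNorm_fderiv_of_le volume (hu k).contDiff_one
      ((subset_tsupport _).trans (hu k).2.2) (F := ℝ) (p := 2) (q := q) (by norm_num)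
      (by rw [hfin]; exact_mod_cast (by linarith : (2 : ℝ) < N)) (by rw [hfin]; simpa using hq)
      hΩbd).trans ?_
    rw [ENNReal.coe_mul]
    gcongr
    exact hgrad k
  obtain ⟨D₂, hD₂⟩ := hsob 2 (by simp)
  obtain ⟨D, hD⟩ := hsob r (by
    rw [hrc]
    have : (0 : ℝ) < N - 2 := by linarith
    apply le_of_eq
    field_simp)
  obtain ⟨φ, hφ, hlim⟩ := exists_subseq_tendsto_lintegral_enorm_sub volume hΩop.measurableSet hΩbd
    (fun k => (hu k).contDiff_one) (fun k => (hu k).2.2) (C := max C₀ D₂)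
    (fun k => (hD₂ k).trans (by exact_mod_cast le_max_right _ _))
    (fun k => (hgrad k).trans (by exact_mod_cast le_max_left _ _))
  refine ⟨φ, hφ, ?_⟩
  have hL1 : Tendsto (fun q : ℕ × ℕ => ∫ x, |u (φ q.1) x - u (φ q.2) x|) atTop (𝓝 0) := by
    have h := (ENNReal.tendsto_toReal ENNReal.zero_ne_top).comp hlim
    simp only [ENNReal.toReal_zero] at h
    refine h.congr fun q => ?_
    rw [Function.comp_apply, ← integral_norm_eq_lintegral_enorm
      ((hu _).sub (hu _)).contDiff_one.continuous.aestronglyMeasurable]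
    rfl
  set P : ℝ := ∫ x in Ω, V x ^ p with hP
  have hP0 : 0 ≤ P := integral_nonneg fun x => Real.rpow_nonneg (hV0 x) _
  set R : ℝ := ((D + D : ℝ≥0) : ℝ) ^ (r : ℝ) with hR
  have hR0 : 0 ≤ R := by positivity
  rw [Metric.tendsto_nhds]
  intro δ hδ
  set η : ℝ := δ / (2 * (P + R + 1)) with hη
  have hη0 : 0 < η := by positivity
  have hηle : η * P + η * R ≤ δ / 2 := by
    have h1 : η * (P + R + 1) = δ / 2 := by rw [hη]; field_simp
    nlinarith
  obtain ⟨A, hA0, hA⟩ := exists_mul_sq_le hp1 hrp hη0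
  have hAlim := hL1.const_mul A
  rw [mul_zero] at hAlim
  filter_upwards [hAlim.eventually_lt_const (half_pos hδ)] with q hq
  have hw := (hu (φ q.1)).sub (hu (φ q.2))
  rw [Real.dist_0_eq_abs, abs_of_nonneg (ven_nonneg hV0)]
  have h1 := (hw.integrable_mul_sq_and_ven_le (by linarith) hr0 hV0 hVp hA).2
  have h2 : ∫ x, |u (φ q.1) x - u (φ q.2) x| ^ (r : ℝ) ≤ R := by
    refine integral_abs_rpow_le hw hr0 ?_
    rw [ENNReal.coe_add]
    refine (eLpNorm_sub_le (hu _).contDiff_one.continuous.aestronglyMeasurable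
      (hu _).contDiff_one.continuous.aestronglyMeasurable ?_).trans (add_le_add (hD _) (hD _))
    have : (1 : ℝ) ≤ r := by
      rw [hrc, le_div_iff₀ (by linarith)]; linarith
    exact_mod_cast this
  have h3 : η * (∫ x, |u (φ q.1) x - u (φ q.2) x| ^ (r : ℝ)) ≤ η * R := by gcongr
  linarith

end Test

/-- **Attainment on bounded domains.** If `Ω` is a nonempty bounded open set and
`V ∈ Lᵖ(Ω)` with `p > N/2`, then `μ_Ω` is attained: every normalized minimizing sequence
has a subsequence whose gradients are Cauchy in `L²(ℝᴺ; ℝᴺ)`. -/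
theorem minimizer_exists_on_bounded_domain
    (N : ℕ) (hN : 3 ≤ N) (Ω : Set (EuclideanSpace ℝ (Fin N)))
    (hΩop : IsOpen Ω) (hΩne : Ω.Nonempty) (hΩbd : Bornology.IsBounded Ω)
    (p : ℝ) (hp : (N : ℝ) / 2 < p)
    (V : EuclideanSpace ℝ (Fin N) → ℝ) (hV0 : ∀ x, 0 ≤ V x)
    (hVp : IntegrableOn (fun x => V x ^ p) Ω)
    (hne : ∃ u₀, IsTest N Ω u₀ ∧ 0 < ven N V u₀) :
    ∀ u : ℕ → EuclideanSpace ℝ (Fin N) → ℝ, MinimizingSeq N V Ω u →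
      ∃ k : ℕ → ℕ, StrictMono k ∧ GradCauchy N (u ∘ k) := by
  intro u ⟨htest, hven, hlim⟩
  have hN' : (3 : ℝ) ≤ N := by exact_mod_cast hN
  have hp1 : 1 < p := by linarith
  obtain ⟨G, hG⟩ := hlim.bddAbove_range
  obtain ⟨φ, hφ, hφlim⟩ := exists_subseq_tendsto_ven_sub hN hΩop hΩbd hp hV0 hVp htest
    (fun k => hG ⟨k, rfl⟩)
  refine ⟨φ, hφ, fun ε hε => ?_⟩
  set m := mu N V Ω with hm
  obtain ⟨A, -, hA⟩ := exists_mul_sq_le hp1 (lt_add_one (2 * (p / (p - 1)))) one_pos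
  have hr0 : 0 < 2 * (p / (p - 1)) + 1 := by
    have : 0 < p / (p - 1) := div_pos (by linarith) (by linarith)
    linarith
  have hint : ∀ {w}, IsTest N Ω w → Integrable (fun x => V x * w x ^ 2) := fun hw =>
    (hw.integrable_mul_sq_and_ven_le (by linarith) hr0 hV0 hVp hA).1
  have hbound : ∀ q : ℕ × ℕ, grad2 N (fun x => u (φ q.1) x - u (φ q.2) x) ≤
      2 * grad2 N (u (φ q.1)) + 2 * grad2 N (u (φ q.2)) - 4 * m +
        m * ven N V (fun x => u (φ q.1) x - u (φ q.2) x) := by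
    intro q
    have h1 := grad2_add_add_grad2_sub (htest (φ q.1)) (htest (φ q.2))
    have ha := (htest (φ q.1)).add (htest (φ q.2))
    have hs := (htest (φ q.1)).sub (htest (φ q.2))
    have h2 := ven_add_add_ven_sub (hint (htest (φ q.1))) (hint (htest (φ q.2))) (hint ha)
      (hint hs)
    have h3 := mu_mul_ven_le hV0 ha
    rw [hven, hven] at h2
    rw [show ven N V (fun x => u (φ q.1) x + u (φ q.2) x) =
      4 - ven N V (fun x => u (φ q.1) x - u (φ q.2) x) by linarith, ← hm] at h3
    linarith
  have hg := hlim.comp hφ.tendsto_atTop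
  have hrhs : Tendsto (fun q : ℕ × ℕ => 2 * grad2 N (u (φ q.1)) + 2 * grad2 N (u (φ q.2)) - 4 * m +
      m * ven N V (fun x => u (φ q.1) x - u (φ q.2) x)) atTop (𝓝 0) := by
    have h1 : Tendsto (fun q : ℕ × ℕ => grad2 N (u (φ q.1))) atTop (𝓝 m) := by
      rw [← prod_atTop_atTop_eq]; exact hg.comp tendsto_fst
    have h2 : Tendsto (fun q : ℕ × ℕ => grad2 N (u (φ q.2))) atTop (𝓝 m) := by
      rw [← prod_atTop_atTop_eq]; exact hg.comp tendsto_snd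
    have h := (((h1.const_mul 2).add (h2.const_mul 2)).sub_const (4 * m)).add (hφlim.const_mul m)
    convert h using 2
    ring
  obtain ⟨⟨a, b⟩, hab⟩ := eventually_atTop.1 (hrhs.eventually_lt_const hε)
  refine ⟨max a b, fun j hj l hl => ?_⟩
  have h := (hbound (j, l)).trans_lt
    (hab (j, l) ⟨(le_max_left a b).trans hj, (le_max_right a b).trans hl⟩)
  have hd : ∀ x, fderiv ℝ ((u ∘ φ) j) x - fderiv ℝ ((u ∘ φ) l) x =
      fderiv ℝ (fun y => u (φ j) y - u (φ l) y) x := fun x =>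
    (fderiv_fun_sub ((htest _).contDiff_one.differentiable one_ne_zero x)
      ((htest _).contDiff_one.differentiable one_ne_zero x)).symm
  simp_rw [hd]
  exact h
end
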